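/- (mem-basic form lemma) For each propositional statement P there is a finite subset A' of A and a mem-basic form P' over A' such that CP_mem ⊢ P = P', where CP_mem is CP extended with the axiom (CPmem) x◁y▷(z◁u▷(v◁y▷w)) = x◁y▷(z◁u▷w). -/

import Mathlib

/-- Propositional statements over atoms `A`: constants `T`, `F`, an atom `a`
for each `a ∈ A`, and the ternary conditional composition
`cond x y z = x ◁ y ▷ z` (with `y` the central condition). -/
inductive PS (A : Type) : Type where
  | tt : PS A
  | ff : PS A
  | atom : A → PS A
  | cond : PS A → PS A → PS A → PS A

/-- A valuation algebra (VA) over `A`. -/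
structure VA (A : Type) where
  Val : Type
  Tv : Val
  Fv : Val
  yd : A → Val → Bool
  dv : A → Val → Val
  yd_T : ∀ a, yd a Tv = true
  yd_F : ∀ a, yd a Fv = false
  dv_T : ∀ a, dv a Tv = Tv
  dv_F : ∀ a, dv a Fv = Fv

variable {A : Type}

mutual
  /-- Evaluation `P/H` of a propositional statement over a valuation `H`. -/
  def PS.eval (V : VA A) : PS A → V.Val → Bool
    | .tt, _ => true
    | .ff, _ => false
    | .atom a, H => V.yd a H
    | .cond p q r, H =>
        if PS.eval V q H then PS.eval V p (PS.deriv V q H)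
        else PS.eval V r (PS.deriv V q H)
  /-- The generalized derivative `∂_P(H)`. -/
  def PS.deriv (V : VA A) : PS A → V.Val → V.Val
    | .tt, H => H
    | .ff, H => H
    | .atom a, H => V.dv a H
    | .cond p q r, H =>
        if PS.eval V q H then PS.deriv V p (PS.deriv V q H)
        else PS.deriv V r (PS.deriv V q H)
end

/-- `K`-equivalence: equal evaluation results in all members of the class `K`. -/
def KEquiv (K : VA A → Prop) (P Q : PS A) : Prop :=
  ∀ V : VA A, K V → ∀ H : V.Val, PS.eval V P H = PS.eval V Q H

/-- A congruence with respect to conditional composition. -/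
def IsCondCongruence (R : PS A → PS A → Prop) : Prop :=
  Equivalence R ∧
    ∀ ⦃x x' y y' z z' : PS A⦄, R x x' → R y y' → R z z' →
      R (PS.cond x y z) (PS.cond x' y' z')

/-- `K`-congruence: the largest congruence contained in `K`-equivalence. -/
def KCong (K : VA A → Prop) (P Q : PS A) : Prop :=
  ∃ R : PS A → PS A → Prop,
    IsCondCongruence R ∧ (∀ x y, R x y → KEquiv K x y) ∧ R P Q

/-- Derivability (of closed equations) in equational logic from the axioms `CP`
together with an additional set `Ax` of equational axioms. -/
inductive Deriv (Ax : PS A → PS A → Prop) : PS A → PS A → Prop where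
  | ax {p q} : Ax p q → Deriv Ax p q
  | cp1 (x y) : Deriv Ax (.cond x .tt y) x
  | cp2 (x y) : Deriv Ax (.cond x .ff y) y
  | cp3 (x) : Deriv Ax (.cond .tt x .ff) x
  | cp4 (x y z u v) :
      Deriv Ax (.cond x (.cond y z u) v)
               (.cond (.cond x y v) z (.cond x u v))
  | refl (x) : Deriv Ax x x
  | symm {p q} : Deriv Ax p q → Deriv Ax q p
  | trans {p q r} : Deriv Ax p q → Deriv Ax q r → Deriv Ax p r
  | congr {x x' y y' z z'} : Deriv Ax x x' → Deriv Ax y y' → Deriv Ax z z' →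
      Deriv Ax (.cond x y z) (.cond x' y' z')

/-- No additional axioms: plain `CP`. -/
def NoAx : PS A → PS A → Prop := fun _ _ => False

/-- The class `fr` of free valuation algebras: all VAs. -/
def frK : VA A → Prop := fun _ => True

/-- The class `rp` of repetition-proof VAs. -/
def rpK (V : VA A) : Prop :=
  ∀ (a : A) (x : V.Val), V.yd a x = V.yd a (V.dv a x)

/-- The class `cr` of contractive VAs. -/
def crK (V : VA A) : Prop :=
  rpK V ∧ ∀ (a : A) (x : V.Val), V.dv a (V.dv a x) = V.dv a x

/-- The class `wm` of weakly memorizing VAs. -/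
def wmK (V : VA A) : Prop :=
  crK V ∧ ∀ (a b : A) (x : V.Val),
    V.yd b (V.dv a x) = V.yd a x →
      V.dv a (V.dv b (V.dv a x)) = V.dv b (V.dv a x) ∧
      V.yd a (V.dv b (V.dv a x)) = V.yd a x

/-- The class `mem` of memorizing VAs. -/
def memK (V : VA A) : Prop :=
  crK V ∧ ∀ (a b : A) (x : V.Val),
    V.dv a (V.dv b (V.dv a x)) = V.dv b (V.dv a x) ∧
    V.yd a (V.dv b (V.dv a x)) = V.yd a x

/-- The class `st` of static VAs. -/
def stK (V : VA A) : Prop :=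
  ∀ (a b : A) (x : V.Val), V.yd a (V.dv b x) = V.yd a x

/-- mem-basic forms over a finite subset `A'` of `A`: `T` and `F` are
mem-basic forms over `A'`, and `P ◁ a ▷ Q` is a mem-basic form over `A'` if
`a ∈ A'` and `P`, `Q` are mem-basic forms over `A' \ {a}`. -/
inductive MemBasic {A : Type} [DecidableEq A] : Finset A → PS A → Prop where
  | tt (s : Finset A) : MemBasic s .tt
  | ff (s : Finset A) : MemBasic s .ff
  | cond {s : Finset A} {p q : PS A} (a : A) :
      a ∈ s → MemBasic (s.erase a) p → MemBasic (s.erase a) q →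
      MemBasic s (.cond p (.atom a) q)

/-- The axiom `(CPmem)`: `x◁y▷(z◁u▷(v◁y▷w)) = x◁y▷(z◁u▷w)`. -/
inductive MemAx {A : Type} : PS A → PS A → Prop where
  | mem (x y z u v w : PS A) :
      MemAx (.cond x y (.cond z u (.cond v y w)))
            (.cond x y (.cond z u w))

namespace Deriv

variable {Ax : PS A → PS A → Prop}

theorem congr_left {x x' : PS A} (y z : PS A) (h : Deriv Ax x x') :
    Deriv Ax (.cond x y z) (.cond x' y z) :=
  .congr h (.refl _) (.refl _)

theorem congr_right (x y : PS A) {z z' : PS A} (h : Deriv Ax z z') :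
    Deriv Ax (.cond x y z) (.cond x y z') :=
  .congr (.refl _) (.refl _) h

/-- Negating the central condition exchanges the two branches. -/
theorem cond_neg (x y z : PS A) :
    Deriv Ax (.cond x y z) (.cond z (.cond .ff y .tt) x) :=
  ((cp4 z .ff y .tt x).trans (.congr (cp2 z x) (.refl _) (cp1 z x))).symm

/-- A condition that has just been evaluated to false need not be evaluated again. -/
theorem cond_self (x y z w : PS A) :
    Deriv MemAx (.cond x y (.cond z y w)) (.cond x y w) :=
  (congr_right x y (cp2 .tt (.cond z y w)).symm).trans
    ((ax (.mem x y .tt .ff z w)).trans (congr_right x y (cp2 .tt w)))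

/-- Interchangeability in the false branch of `y` persists after evaluating `u` to false. -/
theorem cond_right_of_forall {y z z' : PS A}
    (h : ∀ x, Deriv MemAx (.cond x y z) (.cond x y z')) (x u v : PS A) :
    Deriv MemAx (.cond x y (.cond v u z)) (.cond x y (.cond v u z')) :=
  (ax (.mem x y v u .tt z)).symm.trans
    ((congr_right x y (congr_right v u (h .tt))).trans (ax (.mem x y v u .tt z')))

/-- Interchangeability in the false branch of `y` persists after evaluating `u` to true. -/
theorem cond_left_of_forall {y z z' : PS A}
    (h : ∀ x, Deriv MemAx (.cond x y z) (.cond x y z')) (x u v : PS A) :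
    Deriv MemAx (.cond x y (.cond z u v)) (.cond x y (.cond z' u v)) :=
  (congr_right x y (cond_neg z u v)).trans
    ((cond_right_of_forall h x _ v).trans (congr_right x y (cond_neg z' u v).symm))

end Deriv

namespace MemBasic

variable [DecidableEq A]

theorem mono {s t : Finset A} {p : PS A} (hp : MemBasic s p) (hst : s ⊆ t) :
    MemBasic t p := by
  induction hp generalizing t with
  | tt => exact .tt _
  | ff => exact .ff _
  | cond a ha _ _ ihp ihq =>
    exact .cond a (hst ha) (ihp (Finset.erase_subset_erase a hst))
      (ihq (Finset.erase_subset_erase a hst))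

/-- If the false branch of `y` determines the outcome of the atom `a`, then a mem-basic form in
that branch can be replaced by one in which `a` does not occur. -/
theorem exists_erase {s : Finset A} {q y : PS A} {a : A} (hq : MemBasic s q)
    (h : (∀ x z w, Deriv MemAx (.cond x y (.cond z (.atom a) w)) (.cond x y w)) ∨
      (∀ x z w, Deriv MemAx (.cond x y (.cond z (.atom a) w)) (.cond x y z))) :
    ∃ q', MemBasic (s.erase a) q' ∧ ∀ x, Deriv MemAx (.cond x y q) (.cond x y q') := by
  induction hq with
  | tt => exact ⟨_, .tt _, fun _ => .refl _⟩
  | ff => exact ⟨_, .ff _, fun _ => .refl _⟩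
  | @cond s z w b hb hz hw ihz ihw =>
    by_cases hab : b = a
    · subst hab
      rcases h with h | h
      · exact ⟨w, hw, fun x => h x z w⟩
      · exact ⟨z, hz, fun x => h x z w⟩
    · obtain ⟨z', hz', ez⟩ := ihz
      obtain ⟨w', hw', ew⟩ := ihw
      rw [Finset.erase_right_comm] at hz' hw'
      exact ⟨_, .cond b (Finset.mem_erase.2 ⟨hab, hb⟩) hz' hw', fun x =>
        (Deriv.cond_left_of_forall ez x _ w).trans (Deriv.cond_right_of_forall ew x _ z')⟩

theorem exists_cond_atom {s : Finset A} {p q : PS A} {a : A} (ha : a ∈ s)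
    (hp : MemBasic s p) (hq : MemBasic s q) :
    ∃ r, MemBasic s r ∧ Deriv MemAx (.cond p (.atom a) q) r := by
  obtain ⟨q', hq', eq⟩ := hq.exists_erase (y := .atom a) (a := a)
    (.inl fun x z w => Deriv.cond_self x _ z w)
  obtain ⟨p', hp', ep⟩ := hp.exists_erase (y := .cond .ff (.atom a) .tt) (a := a)
    (.inr fun x z w => (Deriv.congr_right x _ (Deriv.cond_neg z _ w)).trans
      (Deriv.cond_self x _ w z))
  exact ⟨_, .cond a ha hp' hq', (eq p).trans ((Deriv.cond_neg _ _ _).trans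
    ((ep q').trans (Deriv.cond_neg _ _ _).symm))⟩

theorem exists_cond {s t : Finset A} {p q r : PS A} (hp : MemBasic s p) (hr : MemBasic s r)
    (hq : MemBasic t q) (hts : t ⊆ s) :
    ∃ m, MemBasic s m ∧ Deriv MemAx (.cond p q r) m := by
  induction hq with
  | tt => exact ⟨p, hp, .cp1 p r⟩
  | ff => exact ⟨r, hr, .cp2 p r⟩
  | cond a ha _ _ ih₁ ih₂ =>
    have hsub := (Finset.erase_subset a _).trans hts
    obtain ⟨m₁, hm₁, e₁⟩ := ih₁ hsub
    obtain ⟨m₂, hm₂, e₂⟩ := ih₂ hsub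
    obtain ⟨m, hm, e⟩ := exists_cond_atom (hts ha) hm₁ hm₂
    exact ⟨m, hm, (Deriv.cp4 _ _ _ _ _).trans ((Deriv.congr e₁ (.refl _) e₂).trans e)⟩

end MemBasic

/-- **mem-basic form lemma**: for each propositional statement `P` there are a
finite subset `A'` of `A` and a mem-basic form `P'` over `A'` such that
`CP_mem ⊢ P = P'`. -/
theorem exists_mem_basic_form {A : Type} [Countable A] [Nontrivial A]
    [DecidableEq A] (P : PS A) :
    ∃ (s : Finset A) (P' : PS A), MemBasic s P' ∧ Deriv MemAx P P' := by
  induction P with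
  | tt => exact ⟨∅, _, .tt _, .refl _⟩
  | ff => exact ⟨∅, _, .ff _, .refl _⟩
  | atom a =>
    exact ⟨{a}, _, .cond a (Finset.mem_singleton_self a) (.tt _) (.ff _), (Deriv.cp3 _).symm⟩
  | cond p q r ihp ihq ihr =>
    obtain ⟨s₁, p', hp, ep⟩ := ihp
    obtain ⟨s₂, q', hq, eq⟩ := ihq
    obtain ⟨s₃, r', hr, er⟩ := ihr
    obtain ⟨m, hm, e⟩ := MemBasic.exists_cond (s := s₁ ∪ s₂ ∪ s₃)
      (hp.mono (by grind)) (hr.mono (by grind)) hq (by grind)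
    exact ⟨_, m, hm, (Deriv.congr ep eq er).trans e⟩
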